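/- For every natural number p ≥ 1 there exists a constant C > 0, depending only on p, such that for every bivariate polynomial q of total degree ≤ p the following holds on the unit square K = (0,1)². For each of the four edges e of K, let γ_e : [0,1] → ℝ² be the affine arclength parametrization of e, and let q̂_e be the unique univariate polynomial of degree ≤ p − 1 satisfying ∫₀¹ (q(γ_e(t)) − q̂_e(t)) t^j dt = 0 for every j = 0, …, p − 1. Let q̂ be the unique bivariate polynomial of total degree ≤ p − 2 satisfying ∫_K (q − q̂) m dx dy = 0 for every bivariate polynomial m of total degree ≤ p − 2 (with q̂ = 0 when p = 1). Then ∫_K |∇q|² dx dy ≤ C ( Σ_{e} ∫₀¹ q̂_e(t)² dt + ∫_K q̂² dx dy ), the sum running over the four edges of K. -/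

import Mathlib

open MeasureTheory

/-- The space of bivariate real polynomials of total degree at most `k`, for an
integer `k` (so that `k < 0` gives the zero space, e.g. `P₋₁ = {0}`). -/
def polyLE (k : ℤ) : Set (MvPolynomial (Fin 2) ℝ) :=
  {m | m = 0 ∨ (0 ≤ k ∧ (m.totalDegree : ℤ) ≤ k)}

/-- Evaluation of a bivariate polynomial at a point of `ℝ × ℝ`. -/
noncomputable def evP (q : MvPolynomial (Fin 2) ℝ) (z : ℝ × ℝ) : ℝ :=
  MvPolynomial.eval ![z.1, z.2] q

/-- Squared Euclidean norm of the gradient of a bivariate polynomial. -/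
noncomputable def gradSqP (q : MvPolynomial (Fin 2) ℝ) (z : ℝ × ℝ) : ℝ :=
  (evP (MvPolynomial.pderiv (0 : Fin 2) q) z) ^ 2 +
    (evP (MvPolynomial.pderiv (1 : Fin 2) q) z) ^ 2

/-- Affine arclength parametrizations of the four edges of the unit square. -/
noncomputable def edgeParam : Fin 4 → ℝ → ℝ × ℝ
  | 0 => fun t => (t, 0)
  | 1 => fun t => (1, t)
  | 2 => fun t => (t, 1)
  | 3 => fun t => (0, t)

abbrev Ksq : Set (ℝ × ℝ) := Set.Ioo (0 : ℝ) 1 ×ˢ Set.Ioo (0 : ℝ) 1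

lemma evP_cont (q : MvPolynomial (Fin 2) ℝ) : Continuous (evP q) := by
  unfold evP
  induction q using MvPolynomial.induction_on with
  | C a => simpa using continuous_const
  | add f g hf hg => simpa using! hf.add hg
  | mul_X f i hf =>
    simp only [map_mul, MvPolynomial.eval_X]
    refine hf.mul ?_
    fin_cases i
    · exact continuous_fst
    · exact continuous_snd

lemma evP_add (f g : MvPolynomial (Fin 2) ℝ) (z) : evP (f + g) z = evP f z + evP g z := by
  simp [evP]

lemma evP_mul (f g : MvPolynomial (Fin 2) ℝ) (z) : evP (f * g) z = evP f z * evP g z := by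
  simp [evP]

lemma evP_smul (c : ℝ) (g : MvPolynomial (Fin 2) ℝ) (z) : evP (c • g) z = c * evP g z := by
  simp [evP]

lemma intK {f : ℝ × ℝ → ℝ} (hf : Continuous f) : IntegrableOn f Ksq := by
  have : IntegrableOn f (Set.Icc (0 : ℝ) 1 ×ˢ Set.Icc (0 : ℝ) 1) :=
    hf.continuousOn.integrableOn_compact (isCompact_Icc.prod isCompact_Icc)
  exact this.mono_set (Set.prod_mono Set.Ioo_subset_Icc_self Set.Ioo_subset_Icc_self)

lemma intI {f : ℝ → ℝ} (hf : Continuous f) : IntegrableOn f (Set.Ioo (0 : ℝ) 1) :=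
  (hf.integrableOn_Icc).mono_set Set.Ioo_subset_Icc_self

lemma edge_cont (i : Fin 4) : Continuous (edgeParam i) := by
  fin_cases i <;> simp only [edgeParam] <;> fun_prop

lemma deriv0 (r : MvPolynomial (Fin 2) ℝ) (x y : ℝ) :
    HasDerivAt (fun t => evP r (t, y)) (evP (MvPolynomial.pderiv 0 r) (x, y)) x := by
  induction r using MvPolynomial.induction_on with
  | C a => simpa [evP] using hasDerivAt_const x a
  | add f g hf hg => simpa [evP_add] using! hf.add hg
  | mul_X f i hf =>
    have hX : HasDerivAt (fun t => evP (MvPolynomial.X i) (t, y))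
        (evP (MvPolynomial.pderiv 0 (MvPolynomial.X i)) (x, y)) x := by
      fin_cases i
      · simpa [evP] using! hasDerivAt_id x
      · simpa [evP, MvPolynomial.pderiv_X] using hasDerivAt_const x y
    rw [MvPolynomial.pderiv_mul]
    simpa only [evP_add, evP_mul] using! hf.mul hX

lemma deriv1 (r : MvPolynomial (Fin 2) ℝ) (x y : ℝ) :
    HasDerivAt (fun t => evP r (x, t)) (evP (MvPolynomial.pderiv 1 r) (x, y)) y := by
  induction r using MvPolynomial.induction_on with
  | C a => simpa [evP] using hasDerivAt_const y a
  | add f g hf hg => simpa [evP_add] using! hf.add hg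
  | mul_X f i hf =>
    have hX : HasDerivAt (fun t => evP (MvPolynomial.X i) (x, t))
        (evP (MvPolynomial.pderiv 1 (MvPolynomial.X i)) (x, y)) y := by
      fin_cases i
      · simpa [evP, MvPolynomial.pderiv_X] using hasDerivAt_const y x
      · simpa [evP] using! hasDerivAt_id y
    rw [MvPolynomial.pderiv_mul]
    simpa only [evP_add, evP_mul] using! hf.mul hX

lemma green1 (r : MvPolynomial (Fin 2) ℝ) :
    ∫ z in Ksq, evP (MvPolynomial.pderiv 1 r) z =
      (∫ t in Set.Ioo (0 : ℝ) 1, evP r (t, 1)) - ∫ t in Set.Ioo (0 : ℝ) 1, evP r (t, 0) := by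
  have h := setIntegral_prod (μ := (volume : Measure ℝ)) (ν := (volume : Measure ℝ))
    (evP (MvPolynomial.pderiv 1 r)) (intK (evP_cont _))
  have c := evP_cont r
  have c' := evP_cont (MvPolynomial.pderiv 1 r)
  rw [← integral_sub (intI (by fun_prop)) (intI (by fun_prop))]
  refine h.trans (integral_congr_ae (Filter.Eventually.of_forall fun x => ?_))
  simp only
  rw [← integral_Ioc_eq_integral_Ioo, ← intervalIntegral.integral_of_le zero_le_one]
  exact intervalIntegral.integral_eq_sub_of_hasDerivAt (fun y _ => deriv1 r x y)
    (Continuous.intervalIntegrable (by fun_prop) _ _)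

lemma green0 (r : MvPolynomial (Fin 2) ℝ) :
    ∫ z in Ksq, evP (MvPolynomial.pderiv 0 r) z =
      (∫ t in Set.Ioo (0 : ℝ) 1, evP r (1, t)) - ∫ t in Set.Ioo (0 : ℝ) 1, evP r (0, t) := by
  have h := setIntegral_prod (μ := (volume : Measure ℝ)) (ν := (volume : Measure ℝ))
    (evP (MvPolynomial.pderiv 0 r)) (intK (evP_cont _))
  have c := evP_cont r
  have c' := evP_cont (MvPolynomial.pderiv 0 r)
  have hs : (∫ x in Set.Ioo (0 : ℝ) 1, ∫ y in Set.Ioo (0 : ℝ) 1,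
      evP (MvPolynomial.pderiv 0 r) (x, y)) = ∫ y in Set.Ioo (0 : ℝ) 1,
      ∫ x in Set.Ioo (0 : ℝ) 1, evP (MvPolynomial.pderiv 0 r) (x, y) := by
    refine integral_integral_swap ?_
    rw [Measure.prod_restrict]
    exact intK c'
  rw [← integral_sub (intI (by fun_prop)) (intI (by fun_prop))]
  refine (h.trans hs).trans (integral_congr_ae (Filter.Eventually.of_forall fun y => ?_))
  simp only
  rw [← integral_Ioc_eq_integral_Ioo, ← intervalIntegral.integral_of_le zero_le_one]
  exact intervalIntegral.integral_eq_sub_of_hasDerivAt (fun x _ => deriv0 r x y)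
    (Continuous.intervalIntegrable (by fun_prop) _ _)

/-- every monomial has degree `d` with `d + k ≤ p` -/
def DegB (p k : ℕ) (q : MvPolynomial (Fin 2) ℝ) : Prop :=
  ∀ s ∈ q.support, s 0 + s 1 + k ≤ p

lemma DegB.pd {p k : ℕ} {q : MvPolynomial (Fin 2) ℝ} (h : DegB p k q) (i : Fin 2) :
    DegB p (k + 1) (MvPolynomial.pderiv i q) := by
  intro s hs
  rw [MvPolynomial.mem_support_iff, MvPolynomial.coeff_pderiv] at hs
  have := h _ (MvPolynomial.mem_support_iff.2 (left_ne_zero_of_mul hs))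
  fin_cases i <;> simp at this <;> omega

lemma degB_zero {p : ℕ} {q : MvPolynomial (Fin 2) ℝ} (h : q.totalDegree ≤ p) : DegB p 0 q := by
  intro s hs
  have := (MvPolynomial.le_totalDegree hs).trans h
  rw [Finsupp.sum_fintype _ _ (by simp)] at this
  simpa using this

lemma evP_sum (q : MvPolynomial (Fin 2) ℝ) (z : ℝ × ℝ) :
    evP q z = ∑ s ∈ q.support, q.coeff s * (z.1 ^ s 0 * z.2 ^ s 1) := by
  simp [evP, MvPolynomial.eval_eq']

lemma mom_int {p : ℕ} {q : MvPolynomial (Fin 2) ℝ}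
    (h : ∀ a b : ℕ, a + b + 2 ≤ p → ∫ z in Ksq, evP q z * (z.1 ^ a * z.2 ^ b) = 0)
    {m : MvPolynomial (Fin 2) ℝ} (hm : DegB p 2 m) : ∫ z in Ksq, evP q z * evP m z = 0 := by
  have c := evP_cont q
  have : ∀ z, evP q z * evP m z =
      ∑ s ∈ m.support, m.coeff s * (evP q z * (z.1 ^ s 0 * z.2 ^ s 1)) := by
    intro z
    rw [evP_sum m, Finset.mul_sum]
    exact Finset.sum_congr rfl fun s _ => by ring
  simp_rw [this]
  rw [integral_finsetSum _ fun s _ => intK (by fun_prop)]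
  refine Finset.sum_eq_zero fun s hs => ?_
  rw [integral_const_mul, h _ _ (hm s hs), mul_zero]

lemma mom_edge {p : ℕ} (f : ℝ → ℝ) (hf : Continuous f)
    (h : ∀ j < p, ∫ t in Set.Ioo (0 : ℝ) 1, f t * t ^ j = 0)
    {m : MvPolynomial (Fin 2) ℝ} (hm : DegB p 1 m) (i : Fin 4) :
    ∫ t in Set.Ioo (0 : ℝ) 1, f t * evP m (edgeParam i t) = 0 := by
  have key : ∀ s : Fin 2 →₀ ℕ, ∃ c : ℝ, ∃ j ≤ s 0 + s 1, ∀ t : ℝ,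
      (edgeParam i t).1 ^ s 0 * (edgeParam i t).2 ^ s 1 = c * t ^ j := by
    intro s
    fin_cases i
    · exact ⟨0 ^ s 1, s 0, by omega, fun t => by simp [edgeParam, mul_comm]⟩
    · exact ⟨1, s 1, by omega, fun t => by simp [edgeParam]⟩
    · exact ⟨1, s 0, by omega, fun t => by simp [edgeParam]⟩
    · exact ⟨0 ^ s 0, s 1, by omega, fun t => by simp [edgeParam]⟩
  choose c j hj hc using key
  have : ∀ t, f t * evP m (edgeParam i t) =
      ∑ s ∈ m.support, (m.coeff s * c s) * (f t * t ^ j s) := by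
    intro z
    rw [evP_sum m, Finset.mul_sum]
    exact Finset.sum_congr rfl fun s _ => by rw [hc]; ring
  simp_rw [this]
  rw [integral_finsetSum _ fun s _ => intI (by fun_prop)]
  refine Finset.sum_eq_zero fun s hs => ?_
  rw [integral_const_mul, h _ (by have := hm s hs; have := hj s; omega), mul_zero]

lemma zero_of_int {m : MvPolynomial (Fin 2) ℝ} (h : ∫ z in Ksq, evP m z ^ 2 = 0) : m = 0 := by
  have c := evP_cont m
  have hz := (setIntegral_eq_zero_iff_of_nonneg_ae
    (Filter.Eventually.of_forall fun z => sq_nonneg (evP m z)) (intK (by fun_prop))).1 h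
  have hE : Set.EqOn (fun z => evP m z ^ 2) (fun _ => 0) Ksq :=
    Measure.eqOn_open_of_ae_eq hz (isOpen_Ioo.prod isOpen_Ioo)
      (by fun_prop) (by fun_prop)
  refine MvPolynomial.funext_set (fun _ => Set.Ioo (0 : ℝ) 1)
    (fun _ => Set.Ioo_infinite zero_lt_one) fun x hx => ?_
  have h1 : (x 0, x 1) ∈ Ksq := ⟨hx 0 trivial, hx 1 trivial⟩
  have h2 := hE h1
  have h3 : evP m (x 0, x 1) = 0 := by simpa using h2
  have h4 : x = ![x 0, x 1] := by ext i; fin_cases i <;> rfl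
  rw [h4, map_zero]; exact h3

lemma kernel {p : ℕ} {q : MvPolynomial (Fin 2) ℝ} (hq : q.totalDegree ≤ p)
    (he : ∀ i : Fin 4, ∀ j < p, ∫ t in Set.Ioo (0 : ℝ) 1, evP q (edgeParam i t) * t ^ j = 0)
    (hK : ∀ a b : ℕ, a + b + 2 ≤ p → ∫ z in Ksq, evP q z * (z.1 ^ a * z.2 ^ b) = 0)  :
    MvPolynomial.pderiv 0 q = 0 ∧ MvPolynomial.pderiv 1 q = 0 := by
  have hd := degB_zero hq
  have c := evP_cont q
  have aux : ∀ k : Fin 2, (∫ z in Ksq, evP (MvPolynomial.pderiv k (q * MvPolynomial.pderiv k q)) z)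
      = ∫ z in Ksq, evP (MvPolynomial.pderiv k q) z ^ 2 := by
    intro k
    have c1 := evP_cont (MvPolynomial.pderiv k q)
    have c2 := evP_cont (MvPolynomial.pderiv k (MvPolynomial.pderiv k q))
    have h0 := mom_int hK ((hd.pd k).pd k)
    rw [← add_zero (∫ z in Ksq, evP (MvPolynomial.pderiv k q) z ^ 2), ← h0,
      ← integral_add (intK (by fun_prop)) (intK (by fun_prop))]
    simp only [MvPolynomial.pderiv_mul, evP_add, evP_mul, sq]
  have he' : ∀ (i : Fin 4) (k : Fin 2),
      ∫ t in Set.Ioo (0 : ℝ) 1, evP (q * MvPolynomial.pderiv k q) (edgeParam i t) = 0 := by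
    intro i k
    simp only [evP_mul]
    exact mom_edge (fun t => evP q (edgeParam i t)) (c.comp (edge_cont i)) (he i) (hd.pd k) i
  refine ⟨zero_of_int ?_, zero_of_int ?_⟩
  · rw [← aux 0, green0]
    exact (congrArg₂ _ (he' 1 0) (he' 3 0)).trans (sub_zero 0)
  · rw [← aux 1, green1]
    exact (congrArg₂ _ (he' 2 1) (he' 0 1)).trans (sub_zero 0)

/-- weighted edge moment -/
noncomputable def momE (i : Fin 4) (j : ℕ) : MvPolynomial (Fin 2) ℝ →ₗ[ℝ] ℝ where
  toFun q := ∫ t in Set.Ioo (0 : ℝ) 1, evP q (edgeParam i t) * t ^ j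
  map_add' f g := by
    have c := (evP_cont f).comp (edge_cont i)
    have c' := (evP_cont g).comp (edge_cont i)
    simp only [Function.comp_def] at c c'
    rw [← integral_add (intI (by fun_prop)) (intI (by fun_prop))]
    simp only [evP_add, add_mul]
  map_smul' r g := by
    simp only [evP_smul, mul_assoc, integral_const_mul, RingHom.id_apply, smul_eq_mul]

/-- interior moment -/
noncomputable def momK (a b : ℕ) : MvPolynomial (Fin 2) ℝ →ₗ[ℝ] ℝ where
  toFun q := ∫ z in Ksq, evP q z * (z.1 ^ a * z.2 ^ b)
  map_add' f g := by
    have c := (evP_cont f)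
    have c' := (evP_cont g)
    rw [← integral_add (intK (by fun_prop)) (intK (by fun_prop))]
    simp only [evP_add, add_mul]
  map_smul' r g := by
    simp only [evP_smul, mul_assoc, integral_const_mul, RingHom.id_apply, smul_eq_mul]

lemma factor {V W ι : Type*} [AddCommGroup V] [Module ℝ V] [AddCommGroup W] [Module ℝ W]
    [Fintype ι] (f : V →ₗ[ℝ] (ι → ℝ)) (g : V →ₗ[ℝ] W) (h : ∀ v, f v = 0 → g v = 0) :
    ∃ w : ι → W, ∀ v, g v = ∑ i, f v i • w i := by
  classical
  obtain ⟨s, hs⟩ := f.rangeRestrict.exists_rightInverse_of_surjective f.range_rangeRestrict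
  obtain ⟨e, hE⟩ := LinearMap.exists_extend (g ∘ₗ s)
  refine ⟨fun i => e (Pi.single i 1), fun v => ?_⟩
  have h1 : e (f v) = g (s (f.rangeRestrict v)) :=
    LinearMap.congr_fun hE (f.rangeRestrict v)
  have h2 : f.rangeRestrict (s (f.rangeRestrict v)) = f.rangeRestrict v :=
    LinearMap.congr_fun hs (f.rangeRestrict v)
  have h3 : f (s (f.rangeRestrict v)) = f v := congrArg Subtype.val h2
  have h4 := h (s (f.rangeRestrict v) - v) (by rw [map_sub, h3, sub_self])
  rw [map_sub, sub_eq_zero] at h4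
  rw [← h4, ← h1]
  conv_lhs => rw [pi_eq_sum_univ' (f v)]
  simp only [map_sum, map_smul]

/-- Cauchy-Schwarz with a weight of modulus at most one, on a set of measure at most one -/
lemma cs_bound {X : Type*} [MeasurableSpace X] (μ : Measure X) [IsProbabilityMeasure μ]
    (f w : X → ℝ) (hfw : Integrable (fun x => f x * w x) μ)
    (hf2 : Integrable (fun x => f x ^ 2) μ) (hw : ∀ᵐ x ∂μ, |w x| ≤ 1) :
    (∫ x, f x * w x ∂μ) ^ 2 ≤ ∫ x, f x ^ 2 ∂μ := by
  set c := ∫ x, f x * w x ∂μ with hc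
  have h : ∫ x, (2 * c * (f x * w x) - c ^ 2) ∂μ ≤ ∫ x, f x ^ 2 ∂μ := by
    refine integral_mono_ae ((hfw.const_mul _).sub (integrable_const _)) hf2 ?_
    filter_upwards [hw] with x hx
    have : (w x) ^ 2 ≤ 1 := by rwa [sq_le_one_iff_abs_le_one]
    nlinarith [sq_nonneg (f x * w x - c), mul_nonneg (sq_nonneg (f x)) (sub_nonneg.2 this)]
  rw [integral_sub (hfw.const_mul _) (integrable_const _), integral_const_mul, ← hc] at h
  simp at h
  linarith

lemma csI (f : ℝ → ℝ) (hf : Continuous f) (j : ℕ) :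
    (∫ t in Set.Ioo (0 : ℝ) 1, f t * t ^ j) ^ 2 ≤ ∫ t in Set.Ioo (0 : ℝ) 1, f t ^ 2 := by
  have : IsProbabilityMeasure (volume.restrict (Set.Ioo (0 : ℝ) 1)) := ⟨by simp⟩
  refine cs_bound _ f (fun t => t ^ j) (intI (by fun_prop)) (intI (by fun_prop)) ?_
  filter_upwards [ae_restrict_mem measurableSet_Ioo] with t ht
  rw [abs_of_nonneg (pow_nonneg ht.1.le _)]
  exact pow_le_one₀ ht.1.le ht.2.le

lemma csK (f : ℝ × ℝ → ℝ) (hf : Continuous f) (a b : ℕ) :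
    (∫ z in Ksq, f z * (z.1 ^ a * z.2 ^ b)) ^ 2 ≤ ∫ z in Ksq, f z ^ 2 := by
  have : IsProbabilityMeasure (volume.restrict Ksq) :=
    ⟨by simp [Ksq, Measure.volume_eq_prod, Measure.prod_prod]⟩
  refine cs_bound _ f (fun z => z.1 ^ a * z.2 ^ b) (intK (by fun_prop)) (intK (by fun_prop)) ?_
  filter_upwards [ae_restrict_mem (measurableSet_Ioo.prod measurableSet_Ioo)] with z hz
  obtain ⟨⟨h1, h2⟩, h3, h4⟩ := hz
  rw [abs_of_nonneg (by positivity)]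
  exact mul_le_one₀ (pow_le_one₀ h1.le h2.le) (by positivity) (pow_le_one₀ h3.le h4.le)

lemma sum_bound {ι : Type*} [Fintype ι] (m : MvPolynomial (Fin 2) ℝ) (x : ι → ℝ)
    (w : ι → MvPolynomial (Fin 2) ℝ) (h : m = ∑ i, x i • w i) (D : ℝ) (hx : ∀ i, x i ^ 2 ≤ D) :
    ∫ z in Ksq, evP m z ^ 2 ≤ (∫ z in Ksq, Fintype.card ι * ∑ i, evP (w i) z ^ 2) * D := by
  have c := evP_cont m
  have cw := fun i => evP_cont (w i)
  rw [← integral_mul_const]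
  refine integral_mono (intK (by fun_prop)) (intK (by fun_prop)) fun z => ?_
  have e : evP m z = ∑ i, x i * evP (w i) z := by
    rw [h]; simp [evP]
  simp only
  rw [e]
  refine (sq_sum_le_card_mul_sum_sq).trans ?_
  rw [mul_assoc, Finset.sum_mul]
  refine mul_le_mul_of_nonneg_left (Finset.sum_le_sum fun i _ => ?_) (by positivity)
  rw [mul_pow, mul_comm]
  exact mul_le_mul_of_nonneg_left (hx i) (sq_nonneg _)

/-- lower stability bound for the "projected" stabilization of the
nodal nonconforming virtual element space on the unit square, for polynomials
`q` of total degree ≤ p: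
`|q|²_{1,K} ≤ C (Σ_e ‖Π^{0,e}_{p-1} q‖²_{0,e} + ‖Π⁰_{p-2} q‖²_{0,K})`. -/
theorem stmt_6 (p : ℕ) (hp : 1 ≤ p) :
    ∃ C : ℝ, 0 < C ∧ ∀ q : MvPolynomial (Fin 2) ℝ, q.totalDegree ≤ p →
      ∀ Qe : Fin 4 → Polynomial ℝ,
        (∀ i : Fin 4, (Qe i).natDegree ≤ p - 1) →
        (∀ i : Fin 4, ∀ j ∈ Finset.range p,
          (∫ t in Set.Ioo (0 : ℝ) 1,
            (evP q (edgeParam i t) - (Qe i).eval t) * t ^ j) = 0) →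
      ∀ qhat : MvPolynomial (Fin 2) ℝ,
        qhat ∈ polyLE ((p : ℤ) - 2) →
        (∀ m ∈ polyLE ((p : ℤ) - 2),
          (∫ z in Set.Ioo (0 : ℝ) 1 ×ˢ Set.Ioo (0 : ℝ) 1,
            (evP q z - evP qhat z) * evP m z) = 0) →
      (∫ z in Set.Ioo (0 : ℝ) 1 ×ˢ Set.Ioo (0 : ℝ) 1, gradSqP q z) ≤
        C * ((∑ i : Fin 4, ∫ t in Set.Ioo (0 : ℝ) 1, ((Qe i).eval t) ^ 2) +
          ∫ z in Set.Ioo (0 : ℝ) 1 ×ˢ Set.Ioo (0 : ℝ) 1, (evP qhat z) ^ 2) := by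
  classical
  let ι := (Fin 4 × Fin p) ⊕ {ab : Fin p × Fin p // (ab.1 : ℕ) + ab.2 + 2 ≤ p}
  let V := MvPolynomial.restrictTotalDegree (Fin 2) ℝ p
  let F : MvPolynomial (Fin 2) ℝ →ₗ[ℝ] (ι → ℝ) := LinearMap.pi fun k =>
    match k with
    | Sum.inl ij => momE ij.1 ij.2
    | Sum.inr ab => momK ab.1.1 ab.1.2
  have hker : ∀ v : V, (F ∘ₗ V.subtype) v = 0 →
      MvPolynomial.pderiv 0 (v : MvPolynomial (Fin 2) ℝ) = 0 ∧
      MvPolynomial.pderiv 1 (v : MvPolynomial (Fin 2) ℝ) = 0 := by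
    intro v hv
    refine kernel ((MvPolynomial.mem_restrictTotalDegree _ _ _).1 v.2) ?_ ?_
    · intro i j hj
      exact congrFun hv (Sum.inl (i, ⟨j, hj⟩))
    · intro a b hab
      exact congrFun hv (Sum.inr ⟨(⟨a, by omega⟩, ⟨b, by omega⟩), hab⟩)
  obtain ⟨w0, hw0⟩ := factor (F ∘ₗ V.subtype)
    ((MvPolynomial.pderiv (0 : Fin 2)).toLinearMap ∘ₗ V.subtype) fun v hv => (hker v hv).1
  obtain ⟨w1, hw1⟩ := factor (F ∘ₗ V.subtype)
    ((MvPolynomial.pderiv (1 : Fin 2)).toLinearMap ∘ₗ V.subtype) fun v hv => (hker v hv).2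
  set A0 := ∫ z in Ksq, Fintype.card ι * ∑ i, evP (w0 i) z ^ 2 with hA0
  set A1 := ∫ z in Ksq, Fintype.card ι * ∑ i, evP (w1 i) z ^ 2 with hA1
  have A0n : 0 ≤ A0 := integral_nonneg fun z => by positivity
  have A1n : 0 ≤ A1 := integral_nonneg fun z => by positivity
  refine ⟨A0 + A1 + 1, by positivity, ?_⟩
  intro q hq Qe _ hQ qhat _ hqh
  set D := ((∑ i : Fin 4, ∫ t in Set.Ioo (0 : ℝ) 1, ((Qe i).eval t) ^ 2) +
          ∫ z in Set.Ioo (0 : ℝ) 1 ×ˢ Set.Ioo (0 : ℝ) 1, (evP qhat z) ^ 2) with hD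
  have hEn : ∀ i ∈ Finset.univ, 0 ≤ ∫ t in Set.Ioo (0 : ℝ) 1, ((Qe i).eval t) ^ 2 := fun i _ =>
    integral_nonneg fun t => sq_nonneg _
  have hKn : 0 ≤ ∫ z in Set.Ioo (0 : ℝ) 1 ×ˢ Set.Ioo (0 : ℝ) 1, (evP qhat z) ^ 2 :=
    integral_nonneg fun t => sq_nonneg _
  have hDn : 0 ≤ D := add_nonneg (Finset.sum_nonneg hEn) hKn
  have c := evP_cont q
  have ch := evP_cont qhat
  have hx : ∀ k, F q k ^ 2 ≤ D := by
    rintro (⟨i, j⟩ | ⟨⟨a, b⟩, hab⟩)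
    · have ce := c.comp (edge_cont i)
      simp only [Function.comp_def] at ce
      have cQ := (Qe i).continuous
      have h1 := hQ i j (Finset.mem_range.2 j.2)
      simp only [sub_mul] at h1
      rw [integral_sub (intI (by fun_prop)) (intI (by fun_prop)), sub_eq_zero] at h1
      have h2 : F q (Sum.inl (i, j)) = ∫ t in Set.Ioo (0 : ℝ) 1, (Qe i).eval t * t ^ (j : ℕ) := h1
      rw [h2]
      have h3 := csI _ cQ j
      have h4 := Finset.single_le_sum hEn (Finset.mem_univ i)
      linarith
    · let s : Fin 2 →₀ ℕ := Finsupp.single 0 (a : ℕ) + Finsupp.single 1 (b : ℕ)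
      have hs : ∀ z, evP (MvPolynomial.monomial s 1) z = z.1 ^ (a : ℕ) * z.2 ^ (b : ℕ) := by
        intro z
        rw [evP, MvPolynomial.eval_monomial, Finsupp.prod_fintype _ _ (by simp)]
        simp [s]
      have hab' : (a : ℕ) + b + 2 ≤ p := hab
      have h1 := hqh (MvPolynomial.monomial s 1) (by
        refine Or.inr ⟨by omega, ?_⟩
        have := MvPolynomial.totalDegree_monomial_le s (1 : ℝ)
        rw [Finsupp.sum_fintype _ _ (by simp)] at this
        rw [Fin.sum_univ_two, id, id] at this
        have s0 : s 0 = a := by simp [s]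
        have s1 : s 1 = b := by simp [s]
        omega)
      simp only [hs, sub_mul] at h1
      rw [integral_sub (intK (by fun_prop)) (intK (by fun_prop)), sub_eq_zero] at h1
      have h2 : F q (Sum.inr ⟨(a, b), hab⟩) =
        ∫ z in Ksq, evP qhat z * (z.1 ^ (a : ℕ) * z.2 ^ (b : ℕ)) := h1
      rw [h2]
      have h3 := csK _ ch a b
      have h4 := Finset.sum_nonneg hEn
      simp only [Ksq] at h3 ⊢
      linarith
  let v : V := ⟨q, (MvPolynomial.mem_restrictTotalDegree _ _ _).2 hq⟩
  have b0 := sum_bound (MvPolynomial.pderiv 0 q) (F q) w0 (hw0 v) D hx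
  have b1 := sum_bound (MvPolynomial.pderiv 1 q) (F q) w1 (hw1 v) D hx
  have c0 := evP_cont (MvPolynomial.pderiv 0 q)
  have c1 := evP_cont (MvPolynomial.pderiv 1 q)
  have hg : (∫ z in Set.Ioo (0 : ℝ) 1 ×ˢ Set.Ioo (0 : ℝ) 1, gradSqP q z) =
      (∫ z in Ksq, evP (MvPolynomial.pderiv 0 q) z ^ 2) +
        ∫ z in Ksq, evP (MvPolynomial.pderiv 1 q) z ^ 2 :=
    integral_add (intK (by fun_prop)) (intK (by fun_prop))
  rw [hg]
  nlinarith
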